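/- Let h : A* → B* be a homomorphism of free monoids and ω an eventually strongly almost periodic sequence over A. If the image h(ω) = h(ω(0))h(ω(1))h(ω(2))… is an infinite sequence, then h(ω) is eventually strongly almost periodic. -/

import Mathlib

/-- The segment of a sequence `ω` of length `l` starting at position `i`,
i.e. the string `ω(i)ω(i+1)…ω(i+l-1)`. -/
def seg {A : Type*} (ω : ℕ → A) (i l : ℕ) : List A :=
  List.ofFn (fun k : Fin l => ω (i + k))

/-- The string `x` occurs in the sequence `ω` starting at position `i`. -/
def OccursAt {A : Type*} (ω : ℕ → A) (x : List A) (i : ℕ) : Prop :=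
  seg ω i x.length = x

/-- A sequence is strongly almost periodic if every string occurring in it
occurs in every segment of some fixed length `l`. -/
def StronglyAP {A : Type*} (ω : ℕ → A) : Prop :=
  ∀ x : List A, (∃ i, OccursAt ω x i) →
    ∃ l, ∀ i, ∃ j, i ≤ j ∧ j + x.length ≤ i + l ∧ OccursAt ω x j

/-- The sequence `aν` obtained by prepending the finite string `a` to the sequence `ν`. -/
def appendSeq {A : Type*} (a : List A) (ν : ℕ → A) : ℕ → A :=
  fun n => if h : n < a.length then a[n]'h else ν (n - a.length)

/-- A sequence is eventually strongly almost periodic if it equals `aν` for some finite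
string `a` and strongly almost periodic sequence `ν`. -/
def EventuallySAP {A : Type*} (ω : ℕ → A) : Prop :=
  ∃ (a : List A) (ν : ℕ → A), StronglyAP ν ∧ ω = appendSeq a ν

/-- The total length of the strings `v 0, …, v (n-1)`, i.e. the position in the
concatenation `v₀v₁v₂…` where `v n` starts. -/
def concatPos {B : Type*} (v : ℕ → List B) (n : ℕ) : ℕ :=
  ∑ m ∈ Finset.range n, (v m).length

/-- The concatenation `v₀v₁v₂…` is infinite. -/
def ConcatInfinite {B : Type*} (v : ℕ → List B) : Prop :=
  ∀ N, ∃ n, N < concatPos v n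

/-- The sequence `β` is the concatenation `v₀v₁v₂…` of the finite strings `v n`. -/
def IsConcatOf {B : Type*} (β : ℕ → B) (v : ℕ → List B) : Prop :=
  ∀ n k, ∀ hk : k < (v n).length, β (concatPos v n + k) = (v n)[k]'hk

theorem occursAt_iff {A : Type*} {ω : ℕ → A} {x : List A} {i : ℕ} :
    OccursAt ω x i ↔ ∀ k, ∀ hk : k < x.length, ω (i + k) = x[k]'hk := by
  unfold OccursAt seg
  constructor
  · intro hx k hk
    have := List.getElem_of_eq hx.symm hk
    simpa using this.symm
  · intro hx
    apply List.ext_getElem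
    · simp
    · intro k h₁ h₂
      simpa using hx k h₂

theorem concatPos_succ {B : Type*} (v : ℕ → List B) (n : ℕ) :
    concatPos v (n + 1) = concatPos v n + (v n).length :=
  Finset.sum_range_succ _ _

theorem concatPos_add {B : Type*} (v : ℕ → List B) (m n : ℕ) :
    concatPos v (m + n) = concatPos v m + concatPos (fun k => v (m + k)) n :=
  Finset.sum_range_add _ _ _

theorem concatPos_mono {B : Type*} (v : ℕ → List B) : Monotone (concatPos v) :=
  monotone_nat_of_le_succ fun n => by rw [concatPos_succ]; omega

theorem concatPos_le_mul {B : Type*} {v : ℕ → List B} {L : ℕ}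
    (hL : ∀ n, (v n).length ≤ L) (n : ℕ) : concatPos v n ≤ n * L := by
  simpa [concatPos] using Finset.sum_le_card_nsmul (Finset.range n) _ L fun m _ => hL m

theorem exists_eq_concatPos_add {B : Type*} {v : ℕ → List B} {t m : ℕ}
    (ht : t < concatPos v m) :
    ∃ n < m, ∃ k < (v n).length, t = concatPos v n + k := by
  induction m with
  | zero => simp [concatPos] at ht
  | succ m ih =>
    by_cases h : t < concatPos v m
    · obtain ⟨n, hn, hk⟩ := ih h
      exact ⟨n, by omega, hk⟩
    · rw [concatPos_succ] at ht
      exact ⟨m, by omega, t - concatPos v m, by omega, by omega⟩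

theorem exists_concatPos_mem_Icc {B : Type*} {v : ℕ → List B} {L : ℕ}
    (hinf : ConcatInfinite v) (hL : ∀ n, (v n).length ≤ L) (N : ℕ) :
    ∃ n, N ≤ concatPos v n ∧ concatPos v n ≤ N + L := by
  classical
  have hex : ∃ n, N ≤ concatPos v n := (hinf N).imp fun _ => le_of_lt
  refine ⟨Nat.find hex, Nat.find_spec hex, ?_⟩
  rcases hn : Nat.find hex with _ | n
  · simp [concatPos]
  · have h₁ : ¬ N ≤ concatPos v n := Nat.find_min hex (by omega)
    have h₂ := hL n
    rw [concatPos_succ]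
    omega

/-- Concatenating the blocks `g (ν n)` along a strongly almost periodic sequence `ν`
gives a strongly almost periodic sequence. -/
theorem StronglyAP.of_isConcatOf {A B : Type*} [Finite A] {ν : ℕ → A} (hν : StronglyAP ν)
    (g : A → List B) {β : ℕ → B} (hinf : ConcatInfinite fun n => g (ν n))
    (hβ : IsConcatOf β fun n => g (ν n)) : StronglyAP β := by
  rintro x ⟨i, hx⟩
  obtain ⟨L, hL⟩ := (Set.finite_range fun c => (g c).length).bddAbove
  replace hL : ∀ n, (g (ν n)).length ≤ L := fun n => hL ⟨ν n, rfl⟩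
  set v : ℕ → List B := fun n => g (ν n) with hv
  obtain ⟨m, hm⟩ := hinf (i + x.length)
  obtain ⟨l, hl⟩ := hν (seg ν 0 m) ⟨0, occursAt_iff.2 fun k hk => by simp [seg]⟩
  refine ⟨L + l * L, fun N => ?_⟩
  obtain ⟨n, hNn, hnN⟩ := exists_concatPos_mem_Icc hinf hL N
  obtain ⟨j, hnj, hjl, hj⟩ := hl n
  have hlen : (seg ν 0 m).length = m := by simp [seg]
  rw [hlen] at hjl
  have hshift : ∀ k < m, ν (j + k) = ν k := fun k hk => by
    have := occursAt_iff.1 hj k (by omega)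
    simpa [seg] using this
  have hpos : ∀ k ≤ m, concatPos v (j + k) = concatPos v j + concatPos v k := fun k hk => by
    rw [concatPos_add]
    congr 1
    refine Finset.sum_congr rfl fun r hr => ?_
    have := Finset.mem_range.1 hr
    simp only [hv, hshift r (by omega)]
  have hcopy : ∀ t < concatPos v m, β (concatPos v j + t) = β t := fun t ht => by
    obtain ⟨r, hr, k, hk, rfl⟩ := exists_eq_concatPos_add ht
    have hvr : v (j + r) = v r := by simp only [hv, hshift r hr]
    rw [← add_assoc, ← hpos r hr.le, hβ (j + r) k (by rw [hvr]; exact hk), hβ r k hk]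
    exact List.getElem_of_eq hvr _
  refine ⟨concatPos v j + i, ?_, ?_, ?_⟩
  · have := concatPos_mono v hnj
    omega
  · have h₁ := hpos m le_rfl
    have h₂ := concatPos_mono v hjl
    have h₃ := concatPos_add v n l
    have h₄ := concatPos_le_mul (fun k => hL (n + k)) l
    simp only [hv] at h₁ h₂ h₃ h₄ hm hnN ⊢
    omega
  · rw [occursAt_iff] at hx ⊢
    intro k hk
    rw [add_assoc, hcopy _ (by omega), hx k hk]

theorem eventuallySAP_of_tail {B : Type*} {β : ℕ → B} (P : ℕ)
    (hβ : StronglyAP fun n => β (P + n)) : EventuallySAP β := by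
  refine ⟨seg β 0 P, _, hβ, funext fun n => ?_⟩
  by_cases hn : n < P
  · simp [appendSeq, seg, hn]
  · simp [appendSeq, seg, hn, Nat.add_sub_cancel' (not_lt.1 hn)]


/-- If `h : A* → B*` is a homomorphism of free monoids, `ω` is an eventually strongly
almost periodic sequence over `A`, and the image `h(ω) = h(ω(0))h(ω(1))h(ω(2))…` is an
infinite sequence `β`, then `β` is eventually strongly almost periodic. -/
theorem homomorphism_preserves_eventuallySAP {A B : Type*} [Fintype A] [Fintype B]
    (h : List A → List B) (hhom : ∀ u v : List A, h (u ++ v) = h u ++ h v)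
    (ω : ℕ → A) (hω : EventuallySAP ω) (β : ℕ → B)
    (hinf : ConcatInfinite (fun n => h [ω n]))
    (hβ : IsConcatOf β (fun n => h [ω n])) :
    EventuallySAP β := by
  obtain ⟨a, ν, hν, rfl⟩ := hω
  have hval : ∀ n, appendSeq a ν (a.length + n) = ν n := fun n => by simp [appendSeq]
  have hadd : ∀ n, concatPos (fun n => h [appendSeq a ν n]) (a.length + n) =
      concatPos (fun n => h [appendSeq a ν n]) a.length + concatPos (fun n => h [ν n]) n :=
    fun n => by simp only [concatPos_add, hval]
  refine eventuallySAP_of_tail (concatPos (fun n => h [appendSeq a ν n]) a.length)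
    (hν.of_isConcatOf (fun c => h [c]) (fun N => ?_) fun n k hk => ?_)
  · obtain ⟨n, hn⟩ := hinf (concatPos (fun n => h [appendSeq a ν n]) a.length + N)
    have := concatPos_mono (fun n => h [appendSeq a ν n]) (Nat.le_add_left n a.length)
    exact ⟨n, by have := hadd n; omega⟩
  · have := hβ (a.length + n) k (by simpa only [hval] using hk)
    simpa only [hadd, hval, add_assoc] using this
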